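/- Let k ≥ 0, z ∈ ℝ, and let σ : ℝ → ℝ be continuously differentiable with bounded derivative. There exists a constant C > 0 depending only on k such that, for every smooth y : [0,1] × ℝ → ℝ which is a C¹ map from time into Schwartz space and satisfies ∂_t y(t,x) = −z σ(x) ∂_x y(t,x), one has H₂(y(1,·)) − H₂(y(0,·)) ≤ C (e^{|z| ‖σ'‖_{L^∞}} − 1) ‖y(0,·)‖_{H¹}² + C (e^{(3/2)|z| ‖σ'‖_{L^∞}} − 1) ‖y(0,·)‖_{H¹}³, where H₂(u) = (1/2)∫_ℝ (u³ + u (u')² + 2k u²) dx. -/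

import Mathlib

open MeasureTheory SchwartzMap

/-- The squared `H¹` norm: `‖w‖_{H¹}² = ∫ (w² + (w')²)`. -/
noncomputable def H1sq (w : ℝ → ℝ) : ℝ := ∫ x : ℝ, ((w x) ^ 2 + (deriv w x) ^ 2)

/-- The Camassa–Holm Hamiltonian `H₂(u) = (1/2) ∫ (u³ + u (u')² + 2k u²)`. -/
noncomputable def H2CH (k : ℝ) (u : ℝ → ℝ) : ℝ :=
  (1 / 2) * ∫ x : ℝ, ((u x) ^ 3 + u x * (deriv u x) ^ 2 + 2 * k * (u x) ^ 2)

theorem SchwartzMap.exists_uniform_decay {y : ℝ → 𝓢(ℝ, ℝ)} (hy : Continuous y) :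
    ∃ K : ℝ, 0 ≤ K ∧ ∀ t ∈ Set.Icc (0 : ℝ) 1, ∀ x : ℝ, |y t x| ≤ K * ((1 + x ^ 2)⁻¹) ^ 2 := by
  have hs (n : ℕ) : ∃ B : ℝ, ∀ t ∈ Set.Icc (0 : ℝ) 1,
      SchwartzMap.seminorm ℝ n 0 (y t) ≤ B := by
    have hc : Continuous fun t => SchwartzMap.seminorm ℝ n 0 (y t) :=
      ((schwartz_withSeminorms ℝ ℝ ℝ).continuous_seminorm (n, 0)).comp hy
    obtain ⟨B, hB⟩ := isCompact_Icc.bddAbove_image (hc.continuousOn (s := Set.Icc (0 : ℝ) 1))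
    exact ⟨B, fun t ht => hB ⟨t, ht, rfl⟩⟩
  obtain ⟨B₀, h₀⟩ := hs 0
  obtain ⟨B₂, h₂⟩ := hs 2
  obtain ⟨B₄, h₄⟩ := hs 4
  have key : ∀ t ∈ Set.Icc (0 : ℝ) 1, ∀ x : ℝ,
      (1 + x ^ 2) ^ 2 * |y t x| ≤ B₀ + 2 * B₂ + B₄ := by
    intro t ht x
    have e₀ := (norm_pow_mul_le_seminorm ℝ (y t) 0 x).trans (h₀ t ht)
    have e₂ := (norm_pow_mul_le_seminorm ℝ (y t) 2 x).trans (h₂ t ht)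
    have e₄ := (norm_pow_mul_le_seminorm ℝ (y t) 4 x).trans (h₄ t ht)
    have a₂ : ‖x‖ ^ 2 = x ^ 2 := by simp
    have a₄ : ‖x‖ ^ 4 = (x ^ 2) ^ 2 := by rw [← a₂]; ring
    rw [a₂] at e₂
    rw [a₄] at e₄
    simp only [pow_zero, one_mul, Real.norm_eq_abs] at e₀ e₂ e₄
    nlinarith
  refine ⟨B₀ + 2 * B₂ + B₄, ?_, fun t ht x => ?_⟩
  · exact le_trans (by positivity) (key 0 (by simp) 0)
  · rw [inv_pow, ← div_eq_mul_inv, le_div_iff₀ (by positivity), mul_comm]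
    exact key t ht x

/-- The energy density `a u² + b v² + c u³ + d u v²`. -/
def energyDensity (a b c d u v : ℝ) : ℝ := a * u ^ 2 + b * v ^ 2 + c * u ^ 3 + d * (u * v ^ 2)

theorem abs_energyDensity_le (a b c d : ℝ) {u v K e : ℝ} (he₀ : 0 ≤ e) (he₁ : e ≤ 1)
    (hu : |u| ≤ K * e) (hv : |v| ≤ K * e) :
    |energyDensity a b c d u v| ≤ ((|a| + |b|) * K ^ 2 + (|c| + |d|) * K ^ 3) * e := by
  rcases he₀.eq_or_lt with rfl | hpos
  · have hu' : u = 0 := by simpa using hu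
    have hv' : v = 0 := by simpa using hv
    simp [energyDensity, hu', hv']
  have hK : 0 ≤ K := nonneg_of_mul_nonneg_left ((abs_nonneg u).trans hu) hpos
  have e₂ : (K * e) ^ 2 ≤ K ^ 2 * e := by
    rw [mul_pow]; gcongr; nlinarith
  have e₃ : (K * e) ^ 3 ≤ K ^ 3 * e := by
    rw [mul_pow]; gcongr; exact pow_le_of_le_one he₀ he₁ (by norm_num)
  have h1 : |u| ^ 2 ≤ K ^ 2 * e := (by gcongr : |u| ^ 2 ≤ (K * e) ^ 2).trans e₂
  have h2 : |v| ^ 2 ≤ K ^ 2 * e := (by gcongr : |v| ^ 2 ≤ (K * e) ^ 2).trans e₂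
  have h3 : |u| ^ 3 ≤ K ^ 3 * e := (by gcongr : |u| ^ 3 ≤ (K * e) ^ 3).trans e₃
  have h4 : |u| * |v| ^ 2 ≤ K ^ 3 * e :=
    (by gcongr : |u| * |v| ^ 2 ≤ (K * e) * (K * e) ^ 2).trans ((by ring : _ = (K * e) ^ 3).trans_le e₃)
  calc |energyDensity a b c d u v|
      ≤ |a| * |u| ^ 2 + |b| * |v| ^ 2 + |c| * |u| ^ 3 + |d| * (|u| * |v| ^ 2) := by
        unfold energyDensity
        refine (abs_add_le _ _).trans (add_le_add ((abs_add_le _ _).trans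
          (add_le_add ((abs_add_le _ _).trans (add_le_add ?_ ?_)) ?_)) ?_) <;>
        simp only [abs_mul, abs_pow, le_refl]
    _ ≤ |a| * (K ^ 2 * e) + |b| * (K ^ 2 * e) + |c| * (K ^ 3 * e) + |d| * (K ^ 3 * e) := by gcongr
    _ = _ := by ring

theorem HasDerivAt.energyDensity {u v : ℝ → ℝ} {u' v' t : ℝ} (a b c d : ℝ)
    (hu : HasDerivAt u u' t) (hv : HasDerivAt v v' t) :
    HasDerivAt (fun s => energyDensity a b c d (u s) (v s))
      ((2 * a * u t + 3 * c * u t ^ 2 + d * v t ^ 2) * u'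
        + (2 * b * v t + 2 * d * (u t * v t)) * v') t := by
  have e := ((((hu.pow 2).const_mul a).add ((hv.pow 2).const_mul b)).add
    ((hu.pow 3).const_mul c)).add ((hu.mul (hv.pow 2)).const_mul d)
  refine HasDerivAt.congr_deriv e ?_
  simp only [Pi.pow_apply]
  norm_num
  ring

theorem inv_one_add_sq_le_one (x : ℝ) : (1 + x ^ 2)⁻¹ ≤ 1 :=
  inv_le_one_of_one_le₀ (by nlinarith)

theorem integrable_inv_one_add_sq_sq : Integrable fun x : ℝ => ((1 + x ^ 2)⁻¹) ^ 2 := by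
  refine integrable_inv_one_add_sq.mono' (by fun_prop) (.of_forall fun x => ?_)
  have h : 0 ≤ (1 + x ^ 2)⁻¹ := by positivity
  rw [Real.norm_of_nonneg (by positivity)]
  exact pow_le_of_le_one h (inv_one_add_sq_le_one x) (by norm_num)

theorem SchwartzMap.continuous_deriv (f : 𝓢(ℝ, ℝ)) : Continuous (deriv f) :=
  (derivCLM ℝ ℝ f).continuous

theorem SchwartzMap.hasDerivAt_deriv (f : 𝓢(ℝ, ℝ)) (x : ℝ) :
    HasDerivAt (deriv f) (deriv (deriv f) x) x :=
  (derivCLM ℝ ℝ f).hasDerivAt x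

theorem continuous_energyDensity (a b c d : ℝ) (f : 𝓢(ℝ, ℝ)) :
    Continuous fun x => energyDensity a b c d (f x) (deriv f x) := by
  have := f.continuous
  have := f.continuous_deriv
  unfold energyDensity
  fun_prop

theorem exists_energyDensity_decay {y : ℝ → 𝓢(ℝ, ℝ)} (hy : Continuous y) (a b c d : ℝ) :
    ∃ K : ℝ, 0 ≤ K ∧ ∀ t ∈ Set.Icc (0 : ℝ) 1, ∀ x : ℝ,
      |energyDensity a b c d (y t x) (deriv (y t) x)| ≤ K * ((1 + x ^ 2)⁻¹) ^ 2 := by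
  obtain ⟨K₀, h₀, hK₀⟩ := exists_uniform_decay hy
  obtain ⟨K₁, h₁, hK₁⟩ := exists_uniform_decay ((derivCLM ℝ ℝ).continuous.comp hy)
  refine ⟨(|a| + |b|) * (K₀ + K₁) ^ 2 + (|c| + |d|) * (K₀ + K₁) ^ 3, by positivity,
    fun t ht x => ?_⟩
  have hw : 0 ≤ (1 + x ^ 2)⁻¹ := by positivity
  refine abs_energyDensity_le a b c d (by positivity) (pow_le_one₀ hw (inv_one_add_sq_le_one x))
    ((hK₀ t ht x).trans ?_) ((hK₁ t ht x).trans ?_) <;> gcongr <;> linarith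

theorem integrable_energyDensity (a b c d : ℝ) (f : 𝓢(ℝ, ℝ)) :
    Integrable fun x => energyDensity a b c d (f x) (deriv f x) := by
  obtain ⟨K, -, hK⟩ := exists_energyDensity_decay (continuous_const (y := f)) a b c d
  exact (integrable_inv_one_add_sq_sq.const_mul K).mono'
    (continuous_energyDensity a b c d f).aestronglyMeasurable (.of_forall (hK 0 (by simp)))

/-- The energy `∫ (a w² + b (w')² + c w³ + d w (w')²)`. -/
noncomputable def energy (a b c d : ℝ) (w : ℝ → ℝ) : ℝ :=
  ∫ x : ℝ, energyDensity a b c d (w x) (deriv w x)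

theorem continuous_apply_path {y : ℝ → 𝓢(ℝ, ℝ)} (hy : Continuous y) (x : ℝ) :
    Continuous fun t => y t x :=
  (BoundedContinuousFunction.evalCLM ℝ x).continuous.comp
    ((toBoundedContinuousFunctionCLM ℝ ℝ ℝ).continuous.comp hy)

theorem continuousOn_energy {y : ℝ → 𝓢(ℝ, ℝ)} (hy : Continuous y) (a b c d : ℝ) :
    ContinuousOn (fun t => energy a b c d (y t)) (Set.Icc 0 1) := by
  obtain ⟨K, -, hK⟩ := exists_energyDensity_decay hy a b c d
  refine continuousOn_of_dominated
    (fun t _ => (continuous_energyDensity a b c d (y t)).aestronglyMeasurable)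
    (fun t ht => .of_forall (hK t ht)) (integrable_inv_one_add_sq_sq.const_mul K)
    (.of_forall fun x => Continuous.continuousOn ?_)
  have h₀ := continuous_apply_path hy x
  have h₁ : Continuous fun t => deriv (y t) x :=
    continuous_apply_path ((derivCLM ℝ ℝ).continuous.comp hy) x
  unfold energyDensity
  fun_prop

/-- `y` is a smooth path of Schwartz functions, on the time interval `[0, 1]`, solving the
transport equation `∂ₜ y = -z σ ∂ₓ y` for a `C¹` field `σ` with `|σ'| ≤ M`. -/
structure IsTransported (z M : ℝ) (σ : ℝ → ℝ) (y : ℝ → 𝓢(ℝ, ℝ)) : Prop where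
  contDiff_field : ContDiff ℝ 1 σ
  abs_deriv_le : ∀ x, |deriv σ x| ≤ M
  contDiffOn : ContDiffOn ℝ (⊤ : ℕ∞) (fun p : ℝ × ℝ => y p.1 p.2) (Set.Icc 0 1 ×ˢ Set.univ)
  continuous : Continuous y
  hasDerivWithinAt : ∀ t ∈ Set.Icc (0 : ℝ) 1, ∀ x : ℝ,
    HasDerivWithinAt (fun s => y s x) (-(z * σ x * deriv (⇑(y t)) x)) (Set.Icc 0 1) t

namespace IsTransported

variable {z M : ℝ} {σ : ℝ → ℝ} {y : ℝ → 𝓢(ℝ, ℝ)}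

theorem nonneg (h : IsTransported z M σ y) : 0 ≤ M :=
  (abs_nonneg _).trans (h.abs_deriv_le 0)

theorem hasDerivAt_field (h : IsTransported z M σ y) (x : ℝ) : HasDerivAt σ (deriv σ x) x :=
  (h.contDiff_field.differentiable (by simp) x).hasDerivAt

theorem continuous_deriv_field (h : IsTransported z M σ y) : Continuous (deriv σ) :=
  h.contDiff_field.continuous_deriv le_rfl

theorem abs_field_mul_le (h : IsTransported z M σ y) (x : ℝ) :
    |σ x| * (1 + x ^ 2)⁻¹ ≤ 2 * (|σ 0| + M) := by
  have hM := h.nonneg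
  have h1 : |σ x - σ 0| ≤ M * |x| := by
    simpa using Convex.norm_image_sub_le_of_norm_deriv_le (s := Set.univ) (x := 0) (y := x)
      (fun x _ => (h.hasDerivAt_field x).differentiableAt) (fun x _ => h.abs_deriv_le x)
      convex_univ trivial trivial
  have h2 : |σ x| ≤ |σ 0| + M * |x| := by
    have := abs_sub_abs_le_abs_sub (σ x) (σ 0)
    linarith
  rw [← div_eq_mul_inv, div_le_iff₀ (by positivity)]
  refine h2.trans ?_
  have hx : |x| ≤ 1 + x ^ 2 := by nlinarith [sq_abs x, sq_nonneg (|x| - 1)]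
  nlinarith [mul_le_mul_of_nonneg_left hx hM, abs_nonneg (σ 0), sq_nonneg x,
    mul_nonneg (abs_nonneg (σ 0)) (sq_nonneg x), mul_nonneg hM (sq_nonneg x)]

theorem hasDerivAt_time (h : IsTransported z M σ y) {t : ℝ} (ht : t ∈ Set.Ioo (0 : ℝ) 1) (x : ℝ) :
    HasDerivAt (fun s => y s x) (-(z * σ x * deriv (y t) x)) t :=
  (h.hasDerivWithinAt t (Set.Ioo_subset_Icc_self ht) x).hasDerivAt (Icc_mem_nhds ht.1 ht.2)

theorem hasDerivAt_time_deriv (h : IsTransported z M σ y) {t : ℝ} (ht : t ∈ Set.Ioo (0 : ℝ) 1)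
    (x : ℝ) :
    HasDerivAt (fun s => deriv (y s) x)
      (-(z * (deriv σ x * deriv (y t) x + σ x * deriv (deriv (y t)) x))) t := by
  set Y : ℝ × ℝ → ℝ := fun p => y p.1 p.2 with hY
  have hsm {s : ℝ} (hs : s ∈ Set.Ioo (0 : ℝ) 1) (ξ : ℝ) : ContDiffAt ℝ (⊤ : ℕ∞) Y (s, ξ) :=
    h.contDiffOn.contDiffAt (prod_mem_nhds (Icc_mem_nhds hs.1 hs.2) Filter.univ_mem)
  have hd {s : ℝ} (hs : s ∈ Set.Ioo (0 : ℝ) 1) (ξ : ℝ) :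
      HasFDerivAt Y (fderiv ℝ Y (s, ξ)) (s, ξ) :=
    ((hsm hs ξ).differentiableAt (by simp)).hasFDerivAt
  have line_t (s ξ : ℝ) : HasDerivAt (fun r : ℝ => (r, ξ)) ((1 : ℝ), (0 : ℝ)) s :=
    (hasDerivAt_id s).prodMk (hasDerivAt_const s ξ)
  have line_x (s ξ : ℝ) : HasDerivAt (fun r : ℝ => (s, r)) ((0 : ℝ), (1 : ℝ)) ξ :=
    (hasDerivAt_const ξ s).prodMk (hasDerivAt_id ξ)
  have part_t {s : ℝ} (hs : s ∈ Set.Ioo (0 : ℝ) 1) (ξ : ℝ) :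
      fderiv ℝ Y (s, ξ) (1, 0) = -(z * (σ ξ * deriv (y s) ξ)) := by
    have e := (hd hs ξ).comp_hasDerivAt s (line_t s ξ)
    rw [HasDerivAt.unique (f := fun r => y r ξ) e (h.hasDerivAt_time hs ξ), mul_assoc]
  have part_x {s : ℝ} (hs : s ∈ Set.Ioo (0 : ℝ) 1) (ξ : ℝ) :
      fderiv ℝ Y (s, ξ) (0, 1) = deriv (y s) ξ :=
    HasDerivAt.unique (f := y s) ((hd hs ξ).comp_hasDerivAt ξ (line_x s ξ)) ((y s).hasDerivAt ξ)
  have hdd : HasFDerivAt (fderiv ℝ Y) (fderiv ℝ (fderiv ℝ Y) (t, x)) (t, x) :=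
    (((hsm ht x).fderiv_right (m := 1) (by norm_cast)).differentiableAt
      (by simp)).hasFDerivAt
  have hsymm : fderiv ℝ (fderiv ℝ Y) (t, x) (1, 0) (0, 1)
      = fderiv ℝ (fderiv ℝ Y) (t, x) (0, 1) (1, 0) :=
    ((hsm ht x).isSymmSndFDerivAt (by simp; norm_cast)) (1, 0) (0, 1)
  have d_xt : HasDerivAt (fun r => fderiv ℝ Y (t, r) (1, 0))
      (fderiv ℝ (fderiv ℝ Y) (t, x) (0, 1) (1, 0)) x :=
    ((ContinuousLinearMap.apply ℝ ℝ ((1 : ℝ), (0 : ℝ))).hasFDerivAt.comp _ hdd).comp_hasDerivAt x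
      (line_x t x)
  have d_tx : HasDerivAt (fun r => fderiv ℝ Y (r, x) (0, 1))
      (fderiv ℝ (fderiv ℝ Y) (t, x) (1, 0) (0, 1)) t := by
    have e := ((ContinuousLinearMap.apply ℝ ℝ ((0 : ℝ), (1 : ℝ))).hasFDerivAt.comp _ hdd).comp_hasDerivAt t
      (line_t t x)
    exact e
  have d_rhs : HasDerivAt (fun r => fderiv ℝ Y (t, r) (1, 0))
      (-(z * (deriv σ x * deriv (y t) x + σ x * deriv (deriv (y t)) x))) x := by
    simp only [part_t ht]
    exact (((h.hasDerivAt_field x).mul ((y t).hasDerivAt_deriv x)).const_mul z).neg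
  rw [← d_xt.unique d_rhs, ← hsymm]
  refine d_tx.congr_of_eventuallyEq ?_
  filter_upwards [isOpen_Ioo.mem_nhds ht] with s hs
  exact (part_x hs x).symm

theorem hasDerivAt_energyDensity (h : IsTransported z M σ y) (a b c d : ℝ) {t : ℝ}
    (ht : t ∈ Set.Ioo (0 : ℝ) 1) (x : ℝ) :
    HasDerivAt (fun s => energyDensity a b c d (y s x) (deriv (y s) x))
      (-(z * (σ x * deriv (y t) x * (2 * a * y t x + 2 * b * deriv (deriv (y t)) x
          + 3 * c * y t x ^ 2 + d * deriv (y t) x ^ 2 + 2 * d * (y t x * deriv (deriv (y t)) x))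
        + deriv σ x * energyDensity 0 (2 * b) 0 (2 * d) (y t x) (deriv (y t) x)))) t := by
  refine ((h.hasDerivAt_time ht x).energyDensity a b c d
    (h.hasDerivAt_time_deriv ht x)).congr_deriv ?_
  simp only [energyDensity]
  ring

theorem hasDerivAt_energy (h : IsTransported z M σ y) (a b c d : ℝ) {t : ℝ}
    (ht : t ∈ Set.Ioo (0 : ℝ) 1) :
    HasDerivAt (fun s => energy a b c d (y s))
      (∫ x, z * deriv σ x * energyDensity a (-b) c (-d) (y t x) (deriv (y t) x)) t := by
  have hM := h.nonneg
  have hcσ := h.contDiff_field.continuous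
  have hcσ' := h.continuous_deriv_field
  have hD : Continuous fun t => derivCLM ℝ ℝ (y t) := (derivCLM ℝ ℝ).continuous.comp h.continuous
  obtain ⟨K₀, h₀, hK₀⟩ := exists_uniform_decay h.continuous
  obtain ⟨K₁, h₁, hK₁⟩ := exists_uniform_decay hD
  obtain ⟨K₂, h₂, hK₂⟩ := exists_uniform_decay ((derivCLM ℝ ℝ).continuous.comp hD)
  obtain ⟨L, hL₀, hL⟩ := exists_energyDensity_decay h.continuous 0 (2 * b) 0 (2 * d)
  set F' : ℝ → ℝ → ℝ := fun s x =>
    -(z * (σ x * deriv (y s) x * (2 * a * y s x + 2 * b * deriv (deriv (y s)) x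
          + 3 * c * y s x ^ 2 + d * deriv (y s) x ^ 2 + 2 * d * (y s x * deriv (deriv (y s)) x))
        + deriv σ x * energyDensity 0 (2 * b) 0 (2 * d) (y s x) (deriv (y s) x))) with hF'
  have hbound : ∀ s ∈ Set.Ioo (0 : ℝ) 1, ∀ x, ‖F' s x‖ ≤
      (|z| * (2 * (|σ 0| + M) * K₁ * (2 * |a| * K₀ + 2 * |b| * K₂ + 3 * |c| * K₀ ^ 2
        + |d| * K₁ ^ 2 + 2 * |d| * (K₀ * K₂)) + M * L)) * (1 + x ^ 2)⁻¹ := by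
    intro s hs x
    have hs' := Set.Ioo_subset_Icc_self hs
    set w := (1 + x ^ 2)⁻¹ with hw
    have hw₀ : 0 ≤ w := by positivity
    have hw₁ : w ≤ 1 := inv_one_add_sq_le_one x
    have hw₂ : w ^ 2 ≤ 1 := pow_le_one₀ hw₀ hw₁
    have hw₃ : w ^ 2 ≤ w := pow_le_of_le_one hw₀ hw₁ (by norm_num)
    have b₀ : |y s x| ≤ K₀ := (hK₀ s hs' x).trans (mul_le_of_le_one_right h₀ hw₂)
    have b₁' : |deriv (y s) x| ≤ K₁ * w ^ 2 := hK₁ s hs' x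
    have b₁ : |deriv (y s) x| ≤ K₁ := b₁'.trans (mul_le_of_le_one_right h₁ hw₂)
    have b₂ : |deriv (deriv (y s)) x| ≤ K₂ :=
      (hK₂ s hs' x).trans (mul_le_of_le_one_right h₂ hw₂)
    have b₃ : |energyDensity 0 (2 * b) 0 (2 * d) (y s x) (deriv (y s) x)| ≤ L * w :=
      (hL s hs' x).trans (by gcongr)
    have b₄ : |σ x| * |deriv (y s) x| ≤ 2 * (|σ 0| + M) * K₁ * w := by
      calc |σ x| * |deriv (y s) x| ≤ |σ x| * (K₁ * w ^ 2) := by gcongr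
        _ = (|σ x| * w) * (K₁ * w) := by ring
        _ ≤ (2 * (|σ 0| + M)) * (K₁ * w) := mul_le_mul_of_nonneg_right (h.abs_field_mul_le x) (by positivity)
        _ = _ := by ring
    have b₅ : |2 * a * y s x + 2 * b * deriv (deriv (y s)) x
          + 3 * c * y s x ^ 2 + d * deriv (y s) x ^ 2 + 2 * d * (y s x * deriv (deriv (y s)) x)|
        ≤ 2 * |a| * K₀ + 2 * |b| * K₂ + 3 * |c| * K₀ ^ 2 + |d| * K₁ ^ 2
          + 2 * |d| * (K₀ * K₂) := by
      refine (abs_add_le _ _).trans (add_le_add ((abs_add_le _ _).trans (add_le_add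
        ((abs_add_le _ _).trans (add_le_add ((abs_add_le _ _).trans (add_le_add ?_ ?_)) ?_))
          ?_)) ?_) <;>
      · simp only [abs_mul, abs_pow, Nat.abs_ofNat]
        gcongr
    rw [Real.norm_eq_abs, hF', abs_neg, abs_mul]
    calc _ ≤ |z| * (|σ x| * |deriv (y s) x| * |2 * a * y s x + 2 * b * deriv (deriv (y s)) x
          + 3 * c * y s x ^ 2 + d * deriv (y s) x ^ 2 + 2 * d * (y s x * deriv (deriv (y s)) x)|
          + |deriv σ x| * |energyDensity 0 (2 * b) 0 (2 * d) (y s x) (deriv (y s) x)|) := by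
          gcongr
          refine (abs_add_le _ _).trans ?_
          simp only [abs_mul, le_refl]
      _ ≤ |z| * (2 * (|σ 0| + M) * K₁ * w * (2 * |a| * K₀ + 2 * |b| * K₂ + 3 * |c| * K₀ ^ 2
          + |d| * K₁ ^ 2 + 2 * |d| * (K₀ * K₂)) + M * (L * w)) := by
          gcongr
          exact h.abs_deriv_le x
      _ = _ := by ring
  have hcy := (y t).continuous
  have hcy' := (y t).continuous_deriv
  have hcy'' : Continuous (deriv (deriv (y t))) := (derivCLM ℝ ℝ (y t)).continuous_deriv
  have hcF' : Continuous (F' t) := by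
    have := continuous_energyDensity 0 (2 * b) 0 (2 * d) (y t)
    fun_prop
  obtain ⟨hint, hder⟩ := hasDerivAt_integral_of_dominated_loc_of_deriv_le
    (μ := volume) (F := fun s x => energyDensity a b c d (y s x) (deriv (y s) x)) (F' := F')
    (isOpen_Ioo.mem_nhds ht)
    (.of_forall fun s => (continuous_energyDensity a b c d (y s)).aestronglyMeasurable)
    (integrable_energyDensity a b c d (y t)) hcF'.aestronglyMeasurable
    (.of_forall fun x s hs => hbound s hs x) (integrable_inv_one_add_sq.const_mul _)
    (.of_forall fun x s hs => h.hasDerivAt_energyDensity a b c d hs x)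
  have hint' : Integrable fun x =>
      z * deriv σ x * energyDensity a (-b) c (-d) (y t x) (deriv (y t) x) :=
    (integrable_energyDensity a (-b) c (-d) (y t)).bdd_mul (c := |z| * M)
      (by fun_prop) (.of_forall fun x => by
        rw [norm_mul]; exact mul_le_mul_of_nonneg_left (h.abs_deriv_le x) (abs_nonneg z))
  obtain ⟨K, hK, hdec⟩ := exists_energyDensity_decay h.continuous a b c d
  have hflux : Integrable fun x =>
      z * (σ x * energyDensity a b c d (y t x) (deriv (y t) x)) := by
    refine Integrable.const_mul ((integrable_inv_one_add_sq.const_mul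
      (2 * (|σ 0| + M) * K)).mono'
      (hcσ.mul (continuous_energyDensity a b c d (y t))).aestronglyMeasurable
      (.of_forall fun x => ?_)) z
    have hw₀ : 0 ≤ (1 + x ^ 2)⁻¹ := by positivity
    calc |σ x * energyDensity a b c d (y t x) (deriv (y t) x)| ≤ |σ x| * (K * ((1 + x ^ 2)⁻¹) ^ 2) := by
          rw [abs_mul]; gcongr; exact hdec t (Set.Ioo_subset_Icc_self ht) x
      _ = (|σ x| * (1 + x ^ 2)⁻¹) * (K * (1 + x ^ 2)⁻¹) := by ring
      _ ≤ (2 * (|σ 0| + M)) * (K * (1 + x ^ 2)⁻¹) := 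
          mul_le_mul_of_nonneg_right (h.abs_field_mul_le x) (by positivity)
      _ = _ := by ring
  have hzero := integral_eq_zero_of_hasDerivAt_of_integrable (f' := fun x =>
      z * deriv σ x * energyDensity a (-b) c (-d) (y t x) (deriv (y t) x) - F' t x)
    (fun x => by
      refine (((h.hasDerivAt_field x).mul (((y t).hasDerivAt x).energyDensity a b c d
        ((y t).hasDerivAt_deriv x))).const_mul z).congr_deriv ?_
      simp only [hF', energyDensity]
      ring)
    (hint'.sub hint) hflux
  rw [integral_sub hint' hint, sub_eq_zero] at hzero
  rw [hzero]
  exact hder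

theorem integral_le (h : IsTransported z M σ y) (f : 𝓢(ℝ, ℝ)) {a b c d A B C D m : ℝ}
    (hle : ∀ x, |energyDensity a b c d (f x) (deriv f x)|
      ≤ m * energyDensity A B C D (f x) (deriv f x)) :
    ∫ x, z * deriv σ x * energyDensity a b c d (f x) (deriv f x)
      ≤ |z| * M * (m * energy A B C D f) := by
  unfold energy
  rw [← integral_const_mul, ← integral_const_mul]
  have hcσ' := h.continuous_deriv_field
  refine integral_mono ((integrable_energyDensity a b c d f).bdd_mul (c := |z| * M)
      (by fun_prop) (.of_forall fun x => by
        rw [norm_mul]; exact mul_le_mul_of_nonneg_left (h.abs_deriv_le x) (abs_nonneg z)))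
      (((integrable_energyDensity A B C D f).const_mul m).const_mul _) fun x => ?_
  refine (le_abs_self _).trans ?_
  rw [abs_mul, abs_mul]
  have := h.nonneg
  have := h.abs_deriv_le x
  gcongr
  exact hle x

end IsTransported

theorem energyDensity_one_one (u v : ℝ) : energyDensity 1 1 0 0 u v = u ^ 2 + v ^ 2 := by
  simp [energyDensity]

theorem H1sq_eq_energy (w : ℝ → ℝ) : H1sq w = energy 1 1 0 0 w := by
  simp only [H1sq, energy, energyDensity_one_one]

theorem H2CH_eq_energy (k : ℝ) (w : ℝ → ℝ) : H2CH k w = 1 / 2 * energy (2 * k) 0 1 1 w := by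
  simp only [H2CH, energy, energyDensity]
  congr 2
  ext x
  ring

theorem H1sq_nonneg (w : ℝ → ℝ) : 0 ≤ H1sq w :=
  integral_nonneg fun _ => by positivity

theorem SchwartzMap.sq_le_H1sq (f : 𝓢(ℝ, ℝ)) (x : ℝ) : f x ^ 2 ≤ H1sq f := by
  have hint : Integrable fun x => f x ^ 2 + deriv f x ^ 2 := by
    simpa only [energyDensity_one_one] using integrable_energyDensity 1 1 0 0 f
  have hcf := f.continuous
  have hcf' := f.continuous_deriv
  have hle (r : ℝ) : 2 * f r * deriv f r ≤ f r ^ 2 + deriv f r ^ 2 := by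
    nlinarith [sq_nonneg (f r - deriv f r)]
  have hint' : Integrable fun x => 2 * f x * deriv f x := by
    refine hint.mono' (by fun_prop) (.of_forall fun r => abs_le.2 ⟨?_, hle r⟩)
    nlinarith [sq_nonneg (f r + deriv f r)]
  have hlim : Filter.Tendsto (fun r => f r ^ 2) Filter.atBot (nhds 0) := by
    simpa using (f.tendsto_cocompact.mono_left atBot_le_cocompact).pow 2
  have hftc := integral_Iic_of_hasDerivAt_of_tendsto (a := x) (f := fun r => f r ^ 2)
    (f' := fun r => 2 * f r * deriv f r) (by fun_prop)
    (fun r _ => ((f.hasDerivAt r).pow 2).congr_deriv (by simp)) hint'.integrableOn hlim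
  rw [sub_zero] at hftc
  rw [← hftc]
  exact (setIntegral_mono hint'.integrableOn hint.integrableOn hle).trans
    (setIntegral_le_integral hint (.of_forall fun r => by positivity))

theorem SchwartzMap.abs_le_sqrt_H1sq (f : 𝓢(ℝ, ℝ)) (x : ℝ) : |f x| ≤ √(H1sq f) :=
  Real.abs_le_sqrt (f.sq_le_H1sq x)

namespace IsTransported

variable {z M : ℝ} {σ : ℝ → ℝ} {y : ℝ → 𝓢(ℝ, ℝ)}

theorem H1sq_le (h : IsTransported z M σ y) {t : ℝ} (ht : t ∈ Set.Icc (0 : ℝ) 1) :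
    H1sq (y t) ≤ Real.exp (|z| * M * t) * H1sq (y 0) := by
  have hanti : AntitoneOn (fun s => Real.exp (-(|z| * M * s)) * energy 1 1 0 0 (y s))
      (Set.Icc 0 1) := by
    have hder : ∀ s ∈ Set.Ioo (0 : ℝ) 1, HasDerivAt
        (fun s => Real.exp (-(|z| * M * s)) * energy 1 1 0 0 (y s)) _ s := fun s hs =>
      (((hasDerivAt_id s).const_mul (|z| * M)).neg.exp).mul (h.hasDerivAt_energy 1 1 0 0 hs)
    refine antitoneOn_of_deriv_nonpos (convex_Icc 0 1)
      (ContinuousOn.mul (by fun_prop) (continuousOn_energy h.continuous 1 1 0 0)) ?_ ?_ <;>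
      rw [interior_Icc]
    · exact fun s hs => (hder s hs).differentiableAt.differentiableWithinAt
    · intro s hs
      rw [(hder s hs).deriv]
      have := h.integral_le (y s) (a := 1) (b := -1) (c := 0) (d := -0) (A := 1) (B := 1)
        (C := 0) (D := 0) (m := 1) fun x => by
          rw [one_mul, energyDensity_one_one, abs_le]
          constructor <;> simp only [energyDensity] <;> nlinarith [sq_nonneg (y s x),
            sq_nonneg (deriv (y s) x)]
      have hexp := Real.exp_pos (-(|z| * M * s))
      simp only [id_eq, mul_one, Pi.neg_apply]
      nlinarith
  have := hanti (Set.left_mem_Icc.2 zero_le_one) ht ht.1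
  simp only [mul_zero, neg_zero, Real.exp_zero, one_mul] at this
  rw [H1sq_eq_energy, H1sq_eq_energy]
  calc _ = Real.exp (|z| * M * t) * (Real.exp (-(|z| * M * t)) * energy 1 1 0 0 (y t)) := by
        rw [← mul_assoc, ← Real.exp_add]; simp
    _ ≤ _ := by gcongr

theorem deriv_H2CH_le (h : IsTransported z M σ y) {k : ℝ} (hk : 0 ≤ k) {t : ℝ}
    (ht : t ∈ Set.Icc (0 : ℝ) 1) :
    ∫ x, z * deriv σ x * energyDensity (2 * k) (-0) 1 (-1) (y t x) (deriv (y t) x)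
      ≤ |z| * M * (Real.exp (3 / 2 * (|z| * M) * t) * √(H1sq (y 0)) ^ 3
        + 2 * k * (Real.exp (|z| * M * t) * H1sq (y 0))) := by
  have hM := h.nonneg
  have hE := h.H1sq_le ht
  have hsqrt : √(H1sq (y t)) ≤ Real.exp (|z| * M * t / 2) * √(H1sq (y 0)) := by
    rw [Real.exp_half, ← Real.sqrt_mul (Real.exp_pos _).le]
    exact Real.sqrt_le_sqrt hE
  have hcube : √(H1sq (y t)) * H1sq (y t)
      ≤ Real.exp (3 / 2 * (|z| * M) * t) * √(H1sq (y 0)) ^ 3 := by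
    calc _ = √(H1sq (y t)) ^ 3 := by
          nth_rw 2 [← Real.sq_sqrt (H1sq_nonneg (y t))]; ring
      _ ≤ (Real.exp (|z| * M * t / 2) * √(H1sq (y 0))) ^ 3 := by gcongr
      _ = _ := by
          rw [mul_pow, ← Real.exp_nat_mul]
          congr 2
          push_cast
          ring
  refine (h.integral_le (y t) (A := 1) (B := 1) (C := 0) (D := 0)
    (m := √(H1sq (y t)) + 2 * k) fun x => ?_).trans ?_
  · rw [energyDensity_one_one]
    have hu := (y t).abs_le_sqrt_H1sq x
    have hs : energyDensity (2 * k) (-0) 1 (-1) (y t x) (deriv (y t) x)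
        = 2 * k * y t x ^ 2 + y t x * (y t x ^ 2 - deriv (y t) x ^ 2) := by
      simp only [energyDensity]; ring
    have hd : |y t x ^ 2 - deriv (y t) x ^ 2| ≤ y t x ^ 2 + deriv (y t) x ^ 2 :=
      abs_le.2 ⟨by nlinarith [sq_nonneg (y t x)], by nlinarith [sq_nonneg (deriv (y t) x)]⟩
    rw [hs]
    calc _ ≤ 2 * k * y t x ^ 2 + |y t x| * |y t x ^ 2 - deriv (y t) x ^ 2| := by
          refine (abs_add_le _ _).trans ?_
          rw [abs_mul (y t x), abs_of_nonneg (by positivity : 0 ≤ 2 * k * y t x ^ 2)]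
      _ ≤ 2 * k * (y t x ^ 2 + deriv (y t) x ^ 2)
          + √(H1sq (y t)) * (y t x ^ 2 + deriv (y t) x ^ 2) := by
          gcongr
          nlinarith [sq_nonneg (deriv (y t) x)]
      _ = _ := by ring
  · rw [← H1sq_eq_energy, add_mul]
    gcongr

theorem H2CH_sub_le (h : IsTransported z M σ y) {k : ℝ} (hk : 0 ≤ k) :
    H2CH k (y 1) - H2CH k (y 0) ≤ k * (Real.exp (|z| * M) - 1) * H1sq (y 0)
      + 1 / 3 * (Real.exp (3 / 2 * (|z| * M)) - 1) * √(H1sq (y 0)) ^ 3 := by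
  set N := √(H1sq (y 0)) ^ 3
  set E := H1sq (y 0)
  have hanti : AntitoneOn (fun s => energy (2 * k) 0 1 1 (y s)
      - (2 / 3 * N * Real.exp (3 / 2 * (|z| * M) * s) + 2 * k * E * Real.exp (|z| * M * s)))
      (Set.Icc 0 1) := by
    have hder : ∀ s ∈ Set.Ioo (0 : ℝ) 1, HasDerivAt (fun s => energy (2 * k) 0 1 1 (y s)
      - (2 / 3 * N * Real.exp (3 / 2 * (|z| * M) * s) + 2 * k * E * Real.exp (|z| * M * s)))
        _ s := fun s hs =>
      (h.hasDerivAt_energy (2 * k) 0 1 1 hs).sub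
        ((((hasDerivAt_id s).const_mul (3 / 2 * (|z| * M))).exp.const_mul (2 / 3 * N)).add
          (((hasDerivAt_id s).const_mul (|z| * M)).exp.const_mul (2 * k * E)))
    refine antitoneOn_of_deriv_nonpos (convex_Icc 0 1)
      (ContinuousOn.sub (continuousOn_energy h.continuous (2 * k) 0 1 1) (by fun_prop)) ?_ ?_ <;>
      rw [interior_Icc]
    · exact fun s hs => (hder s hs).differentiableAt.differentiableWithinAt
    · intro s hs
      rw [(hder s hs).deriv]
      have := h.deriv_H2CH_le hk (Set.Ioo_subset_Icc_self hs)
      simp only [id_eq, mul_one]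
      linarith
  have := hanti (Set.left_mem_Icc.2 zero_le_one) (Set.right_mem_Icc.2 zero_le_one) zero_le_one
  simp only [mul_zero, Real.exp_zero, mul_one] at this
  rw [H2CH_eq_energy, H2CH_eq_energy]
  linarith

end IsTransported

/-- Let `k ≥ 0`. There is a constant `C > 0` depending only on `k` such
that for every `z ∈ ℝ`, every C¹ function `σ` with derivative bounded by `M`, and every smooth
`y : [0,1] × ℝ → ℝ` which is a C¹ map from time into Schwartz space (encoded as below) and
satisfies `∂_t y = −z σ ∂_x y`, one has
`H₂(y(1,·)) − H₂(y(0,·)) ≤ C (e^{|z| ‖σ'‖_{L^∞}} − 1) ‖y(0,·)‖_{H¹}²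
  + C (e^{(3/2)|z| ‖σ'‖_{L^∞}} − 1) ‖y(0,·)‖_{H¹}³`. -/
theorem stmt4 (k : ℝ) (hk : 0 ≤ k) :
    ∃ C > (0 : ℝ), ∀ (z : ℝ) (σ : ℝ → ℝ), ContDiff ℝ 1 σ → ∀ M : ℝ,
      (∀ x : ℝ, |deriv σ x| ≤ M) →
      ∀ y : ℝ → 𝓢(ℝ, ℝ),
        ContDiffOn ℝ (⊤ : ℕ∞) (fun p : ℝ × ℝ => y p.1 p.2) (Set.Icc 0 1 ×ˢ Set.univ) →
        Continuous y →
        (∀ t ∈ Set.Icc (0 : ℝ) 1, ∀ x : ℝ,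
          HasDerivWithinAt (fun s => y s x) (-(z * σ x * deriv (⇑(y t)) x)) (Set.Icc 0 1) t) →
        H2CH k (⇑(y 1)) - H2CH k (⇑(y 0))
          ≤ C * (Real.exp (|z| * M) - 1) * H1sq (⇑(y 0))
            + C * (Real.exp ((3 / 2) * |z| * M) - 1) * Real.sqrt (H1sq (⇑(y 0))) ^ 3 := by
  refine ⟨k + 1, by linarith, fun z σ hσ M hM y hsm hc ht => ?_⟩
  have h : IsTransported z M σ y := ⟨hσ, hM, hsm, hc, ht⟩
  have hzM : 0 ≤ |z| * M := mul_nonneg (abs_nonneg z) h.nonneg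
  have e₁ : 0 ≤ Real.exp (|z| * M) - 1 := sub_nonneg.2 (Real.one_le_exp hzM)
  have e₂ : 0 ≤ Real.exp (3 / 2 * |z| * M) - 1 :=
    sub_nonneg.2 (Real.one_le_exp (by rw [mul_assoc]; positivity))
  have hE := H1sq_nonneg (y 0)
  refine (h.H2CH_sub_le hk).trans ?_
  rw [← mul_assoc (3 / 2 : ℝ)]
  gcongr <;> linarith
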